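/- arXiv:2405.20281 — 2 statements merged into one kernel-verified Lean document; each statement's English description precedes it below -/
import Mathlib

section
/- For every game G, every K ∈ ℤ+, all S, T ∈ ℕ, and every L ∈ ℤ+, the non-uniform security of the salted game satisfies ε_{G_K}(S, T) ≤ 2^{S/L} · (ε_G(T) + L/K). -/
open scoped ENNReal BigOperators

noncomputable section

/-- `{0,1}`-valued indicator of a proposition, in `ℝ≥0∞`. -/
def ind (p : Prop) : ℝ≥0∞ :=
  haveI := Classical.propDecidable p
  if p then 1 else 0

/-- Deterministic oracle algorithms making at most `T` queries, modeled as decision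
trees of depth at most `T`: a query is an element `q : Q`, the oracle's answer to `q`
has type `Ans q`, and the final output has type `O`. -/
inductive DT (Q : Type) (Ans : Q → Type) (O : Type) : ℕ → Type
  | ret {T : ℕ} (o : O) : DT Q Ans O T
  | query {T : ℕ} (q : Q) (cont : Ans q → DT Q Ans O T) : DT Q Ans O (T + 1)

/-- Run a decision tree against an oracle. -/
def DT.run {Q : Type} {Ans : Q → Type} {O : Type} :
    {T : ℕ} → DT Q Ans O T → ((q : Q) → Ans q) → O
  | _, DT.ret o, _ => o
  | _, DT.query q cont, f => DT.run (cont (f q)) f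

/-- The number of queries satisfying `p` made along the execution path on oracle `f`. -/
def DT.countP {Q : Type} {Ans : Q → Type} {O : Type} (p : Q → Prop) :
    {T : ℕ} → DT Q Ans O T → ((q : Q) → Ans q) → ℕ
  | _, DT.ret _, _ => 0
  | _, DT.query q cont, f =>
      (haveI := Classical.propDecidable (p q); if p q then 1 else 0)
        + DT.countP p (cont (f q)) f

/-- A (single-challenge) game: an oracle distribution `μ` over functions
`Fin M → Fin N`, a challenge distribution `π f` for each oracle `f`, and an
accepting outcome set `R f ch` for each oracle and challenge. -/
structure Game where
  M : ℕ
  N : ℕ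
  hM : 0 < M
  hN : 0 < N
  Ch : Type
  chFin : Fintype Ch
  Out : Type
  μ : PMF (Fin M → Fin N)
  π : (Fin M → Fin N) → PMF Ch
  R : (Fin M → Fin N) → Ch → Set Out

attribute [instance] Game.chFin

namespace Game

variable (G : Game)

/-- Winning probability of a deterministic `T`-query algorithm (taking the challenge
as classical input) for the game `G`. -/
def detWinProb {T : ℕ} (a : G.Ch → DT (Fin G.M) (fun _ => Fin G.N) G.Out T) : ℝ≥0∞ :=
  ∑' f : Fin G.M → Fin G.N, G.μ f * ∑' ch : G.Ch, G.π f ch * ind ((a ch).run f ∈ G.R f ch)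

/-- Uniform security `ε_G(T)`: the supremum, over randomized `T`-query algorithms
(probability distributions over deterministic ones), of the winning probability. -/
def unifSec (T : ℕ) : ℝ≥0∞ :=
  ⨆ A : PMF (G.Ch → DT (Fin G.M) (fun _ => Fin G.N) G.Out T),
    ∑' a, A a * G.detWinProb a

/-- Winning probability, in the salted game `G_K`, of a non-uniform algorithm:
a randomized `T`-query algorithm `A` receiving `S` bits of advice together with the
salt and challenge, and an advice function `adv` mapping the joint oracle to `S` bits.
The joint oracle consists of `K` i.i.d. copies `g 0, …, g (K-1)` of the oracle of `G`,
the salt `k` is uniform on `Fin K` and the challenge is drawn from `π (g k)`. -/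
def saltedWinProb (K S T : ℕ)
    (A : PMF ((Fin S → Bool) × Fin K × G.Ch →
      DT (Fin K × Fin G.M) (fun _ => Fin G.N) G.Out T))
    (adv : (Fin K → Fin G.M → Fin G.N) → Fin S → Bool) : ℝ≥0∞ :=
  ∑' g : Fin K → Fin G.M → Fin G.N,
    (∏ k, G.μ (g k)) *
      ((K : ℝ≥0∞)⁻¹ *
        ∑' k : Fin K, ∑' ch : G.Ch, G.π (g k) ch *
          ∑' a, A a *
            ind ((a (adv g, k, ch)).run (fun q => g q.1 q.2) ∈ G.R (g k) ch))

/-- Non-uniform security `ε_{G_K}(S,T)` of the salted game `G_K`: the supremum of the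
winning probability over all non-uniform `(S,T)`-algorithms `(A, adv)`. -/
def saltedNonunifSec (K S T : ℕ) : ℝ≥0∞ :=
  ⨆ (A : PMF ((Fin S → Bool) × Fin K × G.Ch →
      DT (Fin K × Fin G.M) (fun _ => Fin G.N) G.Out T))
    (adv : (Fin K → Fin G.M → Fin G.N) → Fin S → Bool),
    G.saltedWinProb K S T A adv

/-- The marginal probability of a challenge `ch` (for `f ∼ μ`, `ch ∼ π f`). -/
def chProb (ch : G.Ch) : ℝ≥0∞ := ∑' f : Fin G.M → Fin G.N, G.μ f * G.π f ch

/-- The oracle distribution `μ_ch` conditioned on the drawn challenge being `ch`. -/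
def condDist (ch : G.Ch) (f : Fin G.M → Fin G.N) : ℝ≥0∞ :=
  G.μ f * G.π f ch / G.chProb ch

/-- Uniform security `ε_{G_ch}(T)` of the challenge-conditioned plain game `G_ch`:
the supremum over randomized `T`-query algorithms of the probability, for
`f ∼ μ_ch`, that the output lies in `R f ch`. -/
def condSec (ch : G.Ch) (T : ℕ) : ℝ≥0∞ :=
  ⨆ A : PMF (DT (Fin G.M) (fun _ => Fin G.N) G.Out T),
    ∑' a, A a * ∑' f : Fin G.M → Fin G.N, G.condDist ch f * ind (a.run f ∈ G.R f ch)

/-- Uniform security `ε_{G^n}(T')` of the multi-challenge game `G^n`: `n` i.i.d.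
challenges are drawn from `π f` and the algorithm must answer all of them. -/
def multiSec (n T' : ℕ) : ℝ≥0∞ :=
  ⨆ A : PMF ((Fin n → G.Ch) → DT (Fin G.M) (fun _ => Fin G.N) (Fin n → G.Out) T'),
    ∑' a, A a * ∑' f : Fin G.M → Fin G.N, G.μ f *
      ∑' chs : Fin n → G.Ch,
        (∏ j, G.π f (chs j)) * ind (∀ j, (a chs).run f j ∈ G.R f (chs j))

end Game

/-- A plain game: a game without challenges. -/
structure PlainGame where
  M : ℕ
  N : ℕ
  hM : 0 < M
  hN : 0 < N
  Out : Type
  μ : PMF (Fin M → Fin N)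
  R : (Fin M → Fin N) → Set Out

namespace PlainGame

/-- Uniform security `ε_G(T)` of a plain game. -/
def unifSec (G : PlainGame) (T : ℕ) : ℝ≥0∞ :=
  ⨆ A : PMF (DT (Fin G.M) (fun _ => Fin G.N) G.Out T),
    ∑' a, A a * ∑' f : Fin G.M → Fin G.N, G.μ f * ind (a.run f ∈ G.R f)

end PlainGame

/-- Query domain for joint oracle access to the oracles of `k` plain games:
each query is addressed to one of the oracles. -/
abbrev ProdQ {k : ℕ} (Gs : Fin k → PlainGame) : Type := (i : Fin k) × Fin (Gs i).M

/-- Answer type for queries in the direct product. -/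
abbrev ProdAns {k : ℕ} (Gs : Fin k → PlainGame) : ProdQ Gs → Type :=
  fun q => Fin (Gs q.1).N

/-- The joint oracle `(f 0, …, f (k-1))` as a single oracle function. -/
def jointOracle {k : ℕ} {Gs : Fin k → PlainGame}
    (f : (i : Fin k) → Fin (Gs i).M → Fin (Gs i).N) : (q : ProdQ Gs) → ProdAns Gs q :=
  fun q => f q.1 q.2

/-- Winning probability of a `(T 0, …, T (k-1))`-memoryless algorithm, given by
deterministic algorithms `A i` (each making at most `T i` queries and each with
joint oracle access) run sequentially with no shared memory; the oracles are drawn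
independently, and the algorithm wins if every output `(A i).run` is accepted. -/
def memorylessWinProb {k : ℕ} (Gs : Fin k → PlainGame) {T : Fin k → ℕ}
    (A : (i : Fin k) → DT (ProdQ Gs) (ProdAns Gs) (Gs i).Out (T i)) : ℝ≥0∞ :=
  ∑' f : (i : Fin k) → Fin (Gs i).M → Fin (Gs i).N,
    (∏ i, (Gs i).μ (f i)) * ind (∀ i, (A i).run (jointOracle f) ∈ (Gs i).R (f i))

/-- Winning probability of a deterministic algorithm with joint oracle access
outputting a tuple `(e 0, …, e (k-1))` for the direct product game. -/
def jointWinProb {k : ℕ} (Gs : Fin k → PlainGame) {B : ℕ}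
    (A : DT (ProdQ Gs) (ProdAns Gs) ((i : Fin k) → (Gs i).Out) B) : ℝ≥0∞ :=
  ∑' f : (i : Fin k) → Fin (Gs i).M → Fin (Gs i).N,
    (∏ i, (Gs i).μ (f i)) * ind (∀ i, A.run (jointOracle f) i ∈ (Gs i).R (f i))

/-- A deterministic algorithm is `(T 0, …, T (k-1))`-fair if in every execution it
makes at most `T i` queries to the `i`-th oracle. -/
def IsFair {k : ℕ} {Gs : Fin k → PlainGame} {O : Type} {B : ℕ} (T : Fin k → ℕ)
    (A : DT (ProdQ Gs) (ProdAns Gs) O B) : Prop :=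
  ∀ (f : (i : Fin k) → Fin (Gs i).M → Fin (Gs i).N) (i : Fin k),
    A.countP (fun q => q.1 = i) (jointOracle f) ≤ T i

end

namespace DT

variable {Q : Type} {Ans : Q → Type} {O : Type}

/-- Regard a decision tree of depth at most `T` as one of depth at most `T + 1`. -/
def weaken : {T : ℕ} → DT Q Ans O T → DT Q Ans O (T + 1)
  | _, ret o => ret o
  | _, query q c => query q fun y => weaken (c y)

theorem run_weaken : {T : ℕ} → (t : DT Q Ans O T) → (f : (q : Q) → Ans q) →
    t.weaken.run f = t.run f
  | _, ret _, _ => rfl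
  | _, query q c, f => run_weaken (c (f q)) f

theorem exists_eq_ret_or_query {T : ℕ} (t : DT Q Ans O T) :
    (∃ o, t = ret o) ∨ ∃ (T' : ℕ) (q : Q) (c : Ans q → DT Q Ans O T'),
      (⟨T, t⟩ : Σ n, DT Q Ans O n) = ⟨T' + 1, query q c⟩ := by
  cases t with
  | ret o => exact .inl ⟨o, rfl⟩
  | query q c => exact .inr ⟨_, q, c, rfl⟩

variable {ι X Y : Type} [DecidableEq ι]

/-- Answer all queries addressed to the `j`-th oracle according to `f`. -/
def hardwire (j : ι) (f : X → Y) : {T : ℕ} → DT (ι × X) (fun _ => Y) O T →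
    DT ({i // i ≠ j} × X) (fun _ => Y) O T
  | _, ret o => ret o
  | _, query q c =>
    if h : q.1 = j then (hardwire j f (c (f q.2))).weaken
    else query (⟨q.1, h⟩, q.2) fun y => hardwire j f (c y)

theorem run_hardwire (j : ι) (g : ι → X → Y) : {T : ℕ} →
    (t : DT (ι × X) (fun _ => Y) O T) →
    (t.hardwire j (g j)).run (fun q => g q.1 q.2) = t.run fun q => g q.1 q.2
  | _, ret _ => rfl
  | _, query q c => by
    by_cases h : q.1 = j
    · rw [hardwire, dif_pos h, run_weaken, run_hardwire j g, run, ← h]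
    · rw [hardwire, dif_neg h, run, run_hardwire j g, run]

end DT

theorem ENNReal.sum_iSup_le_iSup_sum {α β : Type*} (s : Finset α) (F : α → β → ℝ≥0∞) :
    ∑ y ∈ s, ⨆ b, F y b ≤ ⨆ c : α → β, ∑ y ∈ s, F y (c y) := by
  classical
  rcases isEmpty_or_nonempty β with _ | _
  · simp
  induction s using Finset.induction_on with
  | empty => simp
  | insert a s ha ih =>
    rw [Finset.sum_insert ha]
    refine (add_le_add_right ih _).trans (ENNReal.iSup_add_iSup_le fun b c => ?_)
    refine le_iSup_of_le (Function.update c a b) ?_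
    rw [Finset.sum_insert ha, Function.update_self]
    gcongr with y hy
    rw [Function.update_of_ne (by rintro rfl; exact ha hy)]

theorem Function.exists_mem_periodicPts {α : Type*} [Finite α] [Nonempty α] (q : α → α) :
    ∃ x, x ∈ Function.periodicPts q := by
  obtain ⟨x⟩ := ‹Nonempty α›
  obtain ⟨m, n, hne, h⟩ := Finite.exists_ne_map_eq_of_infinite fun n : ℕ => q^[n] x
  wlog hmn : m < n generalizing m n
  · exact this n m hne.symm h.symm (by omega)
  refine ⟨q^[m] x, Function.mk_mem_periodicPts (n := n - m) (by omega) ?_⟩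
  change q^[n - m] (q^[m] x) = q^[m] x
  rw [← Function.iterate_add_apply, Nat.sub_add_cancel hmn.le]
  exact h.symm

section DirectProduct

variable {X Y O : Type} [Fintype X] [DecidableEq X] [Fintype Y]

/-- The best expected payoff of a depth-`T` decision tree, where `w o f` is the weighted
payoff for the output `o` on the oracle `f`. -/
noncomputable def treeValue (T : ℕ) (w : O → (X → Y) → ℝ≥0∞) : ℝ≥0∞ :=
  ⨆ t : DT X (fun _ => Y) O T, ∑ f, w (t.run f) f

theorem sum_le_treeValue (T : ℕ) (w : O → (X → Y) → ℝ≥0∞) (o : O) :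
    ∑ f, w o f ≤ treeValue T w :=
  le_iSup (fun t : DT X (fun _ => Y) O T => ∑ f, w (t.run f) f) (DT.ret o)

/-- Learning one oracle value costs one query. -/
theorem sum_treeValue_le [DecidableEq Y] (T : ℕ) (w : O → (X → Y) → ℝ≥0∞) (x : X) :
    ∑ y, treeValue T (fun o f => if f x = y then w o f else 0) ≤ treeValue (T + 1) w := by
  refine (ENNReal.sum_iSup_le_iSup_sum _ _).trans (iSup_le fun c => ?_)
  refine le_iSup_of_le (DT.query x c) ?_
  rw [Finset.sum_comm]
  simp [DT.run]

theorem sum_treeValue_const_le [DecidableEq Y] (T : ℕ) (w : O → (X → Y) → ℝ≥0∞) (y₀ : Y) :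
    ∑ y, treeValue T (fun o f => if y₀ = y then w o f else 0) ≤ treeValue T w := by
  rw [Finset.sum_eq_single y₀]
  · simp
  · intro y _ hy
    simp [treeValue, hy.symm]
  · simp

/-- Direct product theorem for forests of decision trees: `t i` may query all the oracles,
but is rewarded only for the `i`-th one. -/
theorem sum_prod_run_le_prod_treeValue [Nonempty Y] (n : ℕ) :
    ∀ {ι : Type} [Fintype ι] [DecidableEq ι] (t : ι → Σ T, DT (ι × X) (fun _ => Y) O T)
      (w : ι → O → (X → Y) → ℝ≥0∞), ∑ i, ((t i).1 + 1) = n →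
      ∑ g : ι → X → Y, ∏ i, w i ((t i).2.run fun q => g q.1 q.2) (g i) ≤
        ∏ i, treeValue (t i).1 (w i) := by
  classical
  induction n using Nat.strong_induction_on with
  | _ n ih =>
  intro ι _ _ t w hn
  rcases isEmpty_or_nonempty ι with _ | _
  · simp
  by_cases hret : ∃ j o, (t j).2 = DT.ret o
  · obtain ⟨j, o, hj⟩ := hret
    rw [← (Equiv.funSplitAt j (X → Y)).symm.sum_comp, Fintype.sum_prod_type,
      Fintype.prod_eq_mul_prod_subtype_ne _ j]
    calc _ ≤ ∑ f, w j o f * ∏ i : {i // i ≠ j}, treeValue (t i).1 (w i) := by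
          refine Finset.sum_le_sum fun f _ => ?_
          have key := ih _ ?_
            (fun i : {i // i ≠ j} => ⟨(t i).1, (t i).2.hardwire j f⟩) (fun i => w i) rfl
          · refine le_trans (le_of_eq ?_) (mul_le_mul_right key (w j o f))
            rw [Finset.mul_sum]
            refine Finset.sum_congr rfl fun g' _ => ?_
            set g := (Equiv.funSplitAt j (X → Y)).symm (f, g') with hg
            have hgj : g j = f := by simp [hg]
            have hgi : ∀ i : {i // i ≠ j}, g i = g' i := fun i => by simp [hg, i.2]
            rw [Fintype.prod_eq_mul_prod_subtype_ne _ j, hj, hgj]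
            congr 1
            refine Finset.prod_congr rfl fun i _ => ?_
            have h := DT.run_hardwire j g (t i).2
            simp only [hgj] at h
            rw [← h, hgi]
            congr 2
            funext q
            rw [hgi]
          · rw [← hn, Fintype.sum_eq_add_sum_subtype_ne _ j]
            dsimp only
            omega
      _ ≤ _ := by
          rw [← Finset.sum_mul]
          gcongr
          exact sum_le_treeValue _ _ o
  · have hq : ∀ i, ∃ (T' : ℕ) (q : ι × X) (c : Y → DT (ι × X) (fun _ => Y) O T'),
        t i = ⟨T' + 1, DT.query q c⟩ := fun i =>
      (DT.exists_eq_ret_or_query (t i).2).resolve_left fun h => hret ⟨i, h⟩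
    choose T q c ht using hq
    obtain rfl : t = fun i => ⟨T i + 1, DT.query (q i) (c i)⟩ := funext ht
    set p : ι → ι := fun i => (q i).1 with hp
    set C := Function.periodicPts p with hC
    have hbij : Set.BijOn p C C := Function.bijOn_periodicPts p
    have hinv := hbij.injOn.leftInvOn_invFunOn
    set ξ : ι → X := fun j => (q (Function.invFunOn p C j)).2 with hξ
    let y₀ : Y := Classical.arbitrary Y
    let ζ : ι → (X → Y) → Y := fun j f => if j ∈ C then f (ξ j) else y₀
    let t' : (ι → Y) → ι → Σ T, DT (ι × X) (fun _ => Y) O T := fun z i =>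
      if i ∈ C then ⟨T i, c i (z (p i))⟩ else ⟨T i + 1, DT.query (q i) (c i)⟩
    let T' : ι → ℕ := fun i => if i ∈ C then T i else T i + 1
    have hT' : ∀ z i, (t' z i).1 = T' i := fun z i => by
      by_cases h : i ∈ C <;> simp [t', T', h]
    let w' : ι → Y → O → (X → Y) → ℝ≥0∞ := fun i y o f => if ζ i f = y then w i o f else 0
    calc _ ≤ ∑ g : ι → X → Y, ∑ z : ι → Y,
            ∏ i, w' i (z i) ((t' z i).2.run fun q => g q.1 q.2) (g i) := by
          refine Finset.sum_le_sum fun g _ => ?_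
          refine le_trans (le_of_eq ?_) (Finset.single_le_sum (fun _ _ => zero_le)
            (Finset.mem_univ fun i => ζ i (g i)))
          refine Finset.prod_congr rfl fun i _ => ?_
          simp only [w', if_true]
          by_cases h : i ∈ C
          · have hζ : ζ (p i) (g (p i)) = g (q i).1 (q i).2 := by
              rw [show ζ (p i) (g (p i)) = g (p i) (ξ (p i)) from if_pos (hbij.mapsTo h)]
              simp only [hξ]
              rw [hinv h]
            rw [show t' (fun i => ζ i (g i)) i = ⟨T i, c i (ζ (p i) (g (p i)))⟩ from if_pos h, hζ]
            rfl
          · rw [show t' (fun i => ζ i (g i)) i = ⟨T i + 1, DT.query (q i) (c i)⟩ from if_neg h]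
      _ ≤ ∑ z : ι → Y, ∏ i, treeValue (T' i) (w' i (z i)) := by
          rw [Finset.sum_comm]
          refine Finset.sum_le_sum fun z _ => ?_
          simp only [← hT' z]
          refine ih _ ?_ (t' z) (fun i => w' i (z i)) rfl
          rw [← hn]
          obtain ⟨i, hi⟩ := Function.exists_mem_periodicPts p
          refine Finset.sum_lt_sum (fun i _ => ?_) ⟨i, Finset.mem_univ i, ?_⟩
          · rw [hT']
            by_cases h : i ∈ C <;> simp [T', h]
          · rw [hT']
            simp [T', hC, hi]
      _ = ∏ i, ∑ y, treeValue (T' i) (w' i y) := by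
          rw [Finset.prod_univ_sum, Fintype.piFinset_univ]
      _ ≤ _ := by
          refine Finset.prod_le_prod' fun i _ => ?_
          by_cases h : i ∈ C
          · simp only [T', w', ζ, h, if_true]
            exact sum_treeValue_le _ _ _
          · simp only [T', w', ζ, h, if_false]
            exact sum_treeValue_const_le _ _ _

end DirectProduct

/-- If products of `W · k` over distinct `k` have mean at most `ε ^ #D`, then the moments of
the average of the `W · k` are bounded as in sampling with collisions. -/
theorem sum_mul_average_pow_mul_prod_le {Ω κ : Type*} [Fintype Ω] [Fintype κ] [DecidableEq κ]
    (E : Ω → ℝ≥0∞) (W : Ω → κ → ℝ≥0∞) (hW : ∀ g k, W g k ≤ 1) (ε : ℝ≥0∞)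
    (hE : ∀ D : Finset κ, ∑ g, E g * ∏ k ∈ D, W g k ≤ ε ^ D.card) (K L : ℕ) (hK : 0 < K)
    (hcard : Fintype.card κ = K) (m : ℕ) :
    ∀ D : Finset κ, m + D.card ≤ L →
      ∑ g, E g * (((K : ℝ≥0∞)⁻¹ * ∑ k, W g k) ^ m * ∏ k ∈ D, W g k) ≤
        (ε + L / K) ^ m * ε ^ D.card := by
  induction m with
  | zero => simpa using fun D _ => hE D
  | succ m ih =>
    intro D hD
    set P : Ω → ℝ≥0∞ := fun g => (K : ℝ≥0∞)⁻¹ * ∑ k, W g k with hP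
    set B : ℝ≥0∞ := ε + L / K with hB
    have hsplit : ∀ g, (∑ k, W g k) * ∏ k ∈ D, W g k ≤
        ∑ k ∈ Dᶜ, ∏ i ∈ insert k D, W g i + D.card * ∏ k ∈ D, W g k := fun g => by
      rw [← Finset.sum_compl_add_sum D, add_mul, Finset.sum_mul]
      refine add_le_add (Finset.sum_le_sum fun k hk => ?_) (mul_le_mul_left ?_ _)
      · rw [Finset.prod_insert (Finset.mem_compl.1 hk)]
      · simpa using Finset.sum_le_sum fun k (_ : k ∈ D) => hW g k
    calc ∑ g, E g * (P g ^ (m + 1) * ∏ k ∈ D, W g k)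
        ≤ ∑ g, (K : ℝ≥0∞)⁻¹ * (∑ k ∈ Dᶜ, E g * (P g ^ m * ∏ i ∈ insert k D, W g i) +
            D.card * (E g * (P g ^ m * ∏ k ∈ D, W g k))) := by
          refine Finset.sum_le_sum fun g _ => ?_
          calc E g * (P g ^ (m + 1) * ∏ k ∈ D, W g k)
              = (K : ℝ≥0∞)⁻¹ * (E g * P g ^ m * ((∑ k, W g k) * ∏ k ∈ D, W g k)) := by
                rw [pow_succ]; simp only [hP]; ring
            _ ≤ (K : ℝ≥0∞)⁻¹ * (E g * P g ^ m *
                  (∑ k ∈ Dᶜ, ∏ i ∈ insert k D, W g i + D.card * ∏ k ∈ D, W g k)) := by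
                gcongr
                exact hsplit g
            _ = _ := by
                simp only [mul_add, Finset.mul_sum, mul_assoc]
                ring_nf
      _ = (K : ℝ≥0∞)⁻¹ * (∑ k ∈ Dᶜ, ∑ g, E g * (P g ^ m * ∏ i ∈ insert k D, W g i) +
            D.card * ∑ g, E g * (P g ^ m * ∏ k ∈ D, W g k)) := by
          rw [← Finset.mul_sum, Finset.sum_add_distrib, Finset.sum_comm, ← Finset.mul_sum]
      _ ≤ (K : ℝ≥0∞)⁻¹ * (∑ k ∈ Dᶜ, B ^ m * ε ^ (D.card + 1) +
            L * (B ^ m * ε ^ D.card)) := by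
          gcongr with k hk
          · have hk' := Finset.card_insert_of_notMem (Finset.mem_compl.1 hk)
            rw [← hk']
            exact ih _ (by omega)
          · omega
          · exact ih D (by omega)
      _ ≤ (K : ℝ≥0∞)⁻¹ * (K * (B ^ m * ε ^ (D.card + 1)) + L * (B ^ m * ε ^ D.card)) := by
          rw [Finset.sum_const, nsmul_eq_mul, ← hcard]
          gcongr
          exact Finset.card_le_univ _
      _ = ((K : ℝ≥0∞)⁻¹ * K) * (B ^ m * ε ^ (D.card + 1)) +
            (K : ℝ≥0∞)⁻¹ * L * (B ^ m * ε ^ D.card) := by ring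
      _ = B ^ (m + 1) * ε ^ D.card := by
          rw [ENNReal.inv_mul_cancel (by simpa using hK.ne') (by simp), pow_succ B, hB,
            div_eq_mul_inv]
          ring

theorem ind_le_one (p : Prop) : ind p ≤ 1 := by
  unfold ind
  split_ifs <;> simp

theorem PMF.sum_coe {α : Type*} [Fintype α] (p : PMF α) : ∑ a, p a = 1 := by
  rw [← tsum_fintype (L := .unconditional _), p.tsum_coe]

namespace Game

variable (G : Game) {K T : ℕ}

/-- The probability, over the challenge, that a deterministic algorithm with access to the
joint oracle `g` answers correctly for the salt `k`. -/
noncomputable def saltWin (a : Fin K × G.Ch → DT (Fin K × Fin G.M) (fun _ => Fin G.N) G.Out T)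
    (g : Fin K → Fin G.M → Fin G.N) (k : Fin K) : ℝ≥0∞ :=
  ∑ ch, G.π (g k) ch * ind ((a (k, ch)).run (fun q => g q.1 q.2) ∈ G.R (g k) ch)

theorem saltWin_le_one (a : Fin K × G.Ch → DT (Fin K × Fin G.M) (fun _ => Fin G.N) G.Out T)
    (g : Fin K → Fin G.M → Fin G.N) (k : Fin K) : G.saltWin a g k ≤ 1 := by
  rw [← (G.π (g k)).sum_coe]
  exact Finset.sum_le_sum fun ch _ => mul_le_of_le_one_right' (ind_le_one _)

theorem sum_treeValue_le_unifSec (T : ℕ) :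
    ∑ ch, treeValue T (fun o f => G.μ f * G.π f ch * ind (o ∈ G.R f ch)) ≤ G.unifSec T := by
  classical
  refine (ENNReal.sum_iSup_le_iSup_sum _ _).trans (iSup_le fun a => ?_)
  refine le_iSup_of_le (PMF.pure a) ?_
  rw [tsum_eq_single a (by simp +contextual [PMF.pure_apply])]
  simp only [PMF.pure_apply, if_true, one_mul, detWinProb, tsum_fintype]
  rw [Finset.sum_comm]
  simp only [Finset.mul_sum, mul_assoc, le_refl]

theorem sum_treeValue_le_one (T : ℕ) :
    ∑ ch, treeValue T (fun (_ : G.Out) f => G.μ f * G.π f ch) ≤ 1 := by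
  calc _ ≤ ∑ ch, ∑ f, G.μ f * G.π f ch :=
        Finset.sum_le_sum fun ch _ => iSup_le fun _ => le_rfl
    _ = 1 := by
        rw [Finset.sum_comm]
        simp only [← Finset.mul_sum, PMF.sum_coe, mul_one]

theorem sum_prod_saltWin_le
    (a : Fin K × G.Ch → DT (Fin K × Fin G.M) (fun _ => Fin G.N) G.Out T) (D : Finset (Fin K)) :
    ∑ g, (∏ k, G.μ (g k)) * ∏ k ∈ D, G.saltWin a g k ≤ G.unifSec T ^ D.card := by
  classical
  have : Nonempty (Fin G.N) := ⟨⟨0, G.hN⟩⟩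
  let w : Fin K → G.Ch → G.Out → (Fin G.M → Fin G.N) → ℝ≥0∞ := fun k ch o f =>
    if k ∈ D then G.μ f * G.π f ch * ind (o ∈ G.R f ch) else G.μ f * G.π f ch
  calc ∑ g, (∏ k, G.μ (g k)) * ∏ k ∈ D, G.saltWin a g k
      = ∑ g : Fin K → Fin G.M → Fin G.N,
          ∏ k, ∑ ch, w k ch ((a (k, ch)).run fun q => g q.1 q.2) (g k) := by
        refine Finset.sum_congr rfl fun g _ => ?_
        rw [← Fintype.prod_ite_mem D, ← Finset.prod_mul_distrib]
        refine Finset.prod_congr rfl fun k _ => ?_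
        by_cases hk : k ∈ D
        · simp only [hk, if_true, w, saltWin, Finset.mul_sum, mul_assoc]
        · simp only [hk, if_false, w, ← Finset.mul_sum, PMF.sum_coe]
    _ = ∑ c : Fin K → G.Ch, ∑ g : Fin K → Fin G.M → Fin G.N,
          ∏ k, w k (c k) ((a (k, c k)).run fun q => g q.1 q.2) (g k) := by
        simp only [Finset.prod_univ_sum, Fintype.piFinset_univ]
        rw [Finset.sum_comm]
    _ ≤ ∑ c : Fin K → G.Ch, ∏ k, treeValue T (w k (c k)) :=
        Finset.sum_le_sum fun c _ => sum_prod_run_le_prod_treeValue _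
          (fun k => ⟨T, a (k, c k)⟩) (fun k => w k (c k)) rfl
    _ = ∏ k, ∑ ch, treeValue T (w k ch) := by
        rw [Finset.prod_univ_sum, Fintype.piFinset_univ]
    _ ≤ ∏ k, if k ∈ D then G.unifSec T else 1 := by
        refine Finset.prod_le_prod' fun k _ => ?_
        by_cases hk : k ∈ D
        · simp only [hk, if_true, w]
          exact G.sum_treeValue_le_unifSec T
        · simp only [hk, if_false, w]
          exact G.sum_treeValue_le_one T
    _ = G.unifSec T ^ D.card := by
        rw [Fintype.prod_ite_mem, Finset.prod_const]

/-- The bound of `salted_nonuniform_le` for deterministic algorithms. -/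
theorem sum_average_saltWin_le (hK : 0 < K) (S L : ℕ) (hL : 0 < L)
    (a : (Fin S → Bool) × Fin K × G.Ch → DT (Fin K × Fin G.M) (fun _ => Fin G.N) G.Out T)
    (adv : (Fin K → Fin G.M → Fin G.N) → Fin S → Bool) :
    ∑ g, (∏ k, G.μ (g k)) * ((K : ℝ≥0∞)⁻¹ * ∑ k, G.saltWin (fun q => a (adv g, q)) g k) ≤
      (2 : ℝ≥0∞) ^ ((S : ℝ) / (L : ℝ)) * (G.unifSec T + (L : ℝ≥0∞) / (K : ℝ≥0∞)) := by
  rw [← ENNReal.pow_le_pow_left_iff hL.ne', mul_pow]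
  let P : (Fin S → Bool) → (Fin K → Fin G.M → Fin G.N) → ℝ≥0∞ := fun s g =>
    (K : ℝ≥0∞)⁻¹ * ∑ k, G.saltWin (fun q => a (s, q)) g k
  have hE : ∑ g : Fin K → Fin G.M → Fin G.N, ∏ k, G.μ (g k) = 1 := by
    rw [← Fintype.piFinset_univ, ← Finset.prod_univ_sum]
    simp [PMF.sum_coe]
  have hpow : ((2 : ℝ≥0∞) ^ ((S : ℝ) / (L : ℝ))) ^ L = 2 ^ S := by
    rw [← ENNReal.rpow_natCast, ← ENNReal.rpow_mul,
      div_mul_cancel₀ _ (by exact_mod_cast hL.ne'), ENNReal.rpow_natCast]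
  calc (∑ g, (∏ k, G.μ (g k)) * P (adv g) g) ^ L
      ≤ ∑ g, (∏ k, G.μ (g k)) * P (adv g) g ^ L := by
        simpa only [ENNReal.rpow_natCast] using ENNReal.rpow_arith_mean_le_arith_mean_rpow
          Finset.univ (fun g => ∏ k, G.μ (g k)) (fun g => P (adv g) g) hE
          (p := L) (by exact_mod_cast hL)
    _ ≤ ∑ g, ∑ s, (∏ k, G.μ (g k)) * P s g ^ L :=
        Finset.sum_le_sum fun g _ => Finset.single_le_sum
          (f := fun s => (∏ k, G.μ (g k)) * P s g ^ L) (fun _ _ => zero_le)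
          (Finset.mem_univ (adv g))
    _ = ∑ s, ∑ g, (∏ k, G.μ (g k)) * P s g ^ L := Finset.sum_comm
    _ ≤ ∑ _s : Fin S → Bool, (G.unifSec T + L / K) ^ L := by
        refine Finset.sum_le_sum fun s _ => ?_
        simpa using sum_mul_average_pow_mul_prod_le (fun g => ∏ k, G.μ (g k))
          (G.saltWin fun q => a (s, q)) (G.saltWin_le_one _) (G.unifSec T)
          (G.sum_prod_saltWin_le _) K L hK (Fintype.card_fin K) L ∅ (by simp)
    _ = _ := by simp [hpow]

theorem saltedWinProb_eq_tsum (K S T : ℕ)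
    (A : PMF ((Fin S → Bool) × Fin K × G.Ch →
      DT (Fin K × Fin G.M) (fun _ => Fin G.N) G.Out T))
    (adv : (Fin K → Fin G.M → Fin G.N) → Fin S → Bool) :
    G.saltedWinProb K S T A adv = ∑' a, A a *
      ∑ g, (∏ k, G.μ (g k)) *
        ((K : ℝ≥0∞)⁻¹ * ∑ k, G.saltWin (fun q => a (adv g, q)) g k) := by
  unfold saltedWinProb saltWin
  simp only [tsum_fintype, Finset.mul_sum, ← ENNReal.tsum_mul_left]
  simp only [Summable.tsum_finsetSum fun _ _ => ENNReal.summable]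
  refine Finset.sum_congr rfl fun g _ => Finset.sum_congr rfl fun k _ =>
    Finset.sum_congr rfl fun ch _ => tsum_congr fun a => ?_
  ring

end Game

/-- For every game `G`, every `K ∈ ℤ+`, all `S, T ∈ ℕ` and every
`L ∈ ℤ+`, the non-uniform security of the salted game satisfies
`ε_{G_K}(S, T) ≤ 2^{S/L} · (ε_G(T) + L/K)`. -/
theorem salted_nonuniform_le (G : Game) (K : ℕ) (hK : 0 < K) (S T : ℕ)
    (L : ℕ) (hL : 0 < L) :
    G.saltedNonunifSec K S T ≤
      (2 : ℝ≥0∞) ^ ((S : ℝ) / (L : ℝ)) * (G.unifSec T + (L : ℝ≥0∞) / (K : ℝ≥0∞)) := by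
  refine iSup₂_le fun A adv => ?_
  rw [G.saltedWinProb_eq_tsum]
  calc _ ≤ ∑' a, A a * ((2 : ℝ≥0∞) ^ ((S : ℝ) / (L : ℝ)) * (G.unifSec T + L / K)) :=
        ENNReal.tsum_le_tsum fun a => by
          gcongr
          exact G.sum_average_saltWin_le hK S L hL a adv
    _ = _ := by rw [ENNReal.tsum_mul_right, A.tsum_coe, one_mul]
end

section
/- Let G be a game with oracle distribution μ and challenge distributions π_f, let K ∈ ℤ+, T ∈ ℕ, and n_1,…,n_K ∈ ℕ. Sample f_1,…,f_K ∼ μ independently and, for each k ∈ [K], sample challenges ch_k^1,…,ch_k^{n_k} i.i.d. from π_{f_k}. Let B be a deterministic T-query oracle algorithm taking a (salt, challenge) pair as input, with joint oracle access to (f_1,…,f_K), and run B sequentially (with no shared memory between executions) on all inputs (k, ch_k^j) for k ∈ [K], j ∈ [n_k]. Then Pr[ for all k ∈ [K] and j ∈ [n_k], the output of B on (k, ch_k^j) lies in R_{f_k, ch_k^j} ] ≤ ∏_{k=1}^K ε_{G^{n_k}}(n_k·T). -/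
open scoped ENNReal BigOperators

namespace DT

/-- The first query of a decision tree, if it makes any. -/
def head {Q : Type} {Ans : Q → Type} {O : Type} : {T : ℕ} → DT Q Ans O T → Option Q
  | _, ret _ => none
  | _, query q _ => some q

theorem exists_succ_run_eq {Q : Type} {Ans : Q → Type} {O : Type} {T : ℕ} (a : DT Q Ans O T) :
    ∃ b : DT Q Ans O (T + 1), ∀ f, b.run f = a.run f := by
  induction a with
  | ret o => exact ⟨ret o, fun _ => rfl⟩
  | query q cont ih =>
    choose b hb using ih
    exact ⟨query q b, fun f => by simp only [run, hb]⟩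

theorem exists_add_run_eq {Q : Type} {Ans : Q → Type} {O : Type} {S : ℕ} (a : DT Q Ans O S)
    (T : ℕ) : ∃ b : DT Q Ans O (S + T), ∀ f, b.run f = a.run f := by
  induction T with
  | zero => exact ⟨a, fun _ => rfl⟩
  | succ T ih =>
    obtain ⟨b, hb⟩ := ih
    obtain ⟨c, hc⟩ := exists_succ_run_eq b
    exact ⟨c, fun f => (hc f).trans (hb f)⟩

theorem exists_bind {Q : Type} {Ans : Q → Type} {O O' : Type} {S T : ℕ} (a : DT Q Ans O T)
    (c : O → DT Q Ans O' S) :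
    ∃ b : DT Q Ans O' (S + T), ∀ f, b.run f = (c (a.run f)).run f := by
  induction a with
  | @ret T o => exact exists_add_run_eq (c o) T
  | query q cont ih =>
    choose b hb using ih
    exact ⟨query q b, fun f => by simp only [run, hb]⟩

theorem exists_pi {Q : Type} {Ans : Q → Type} {O : Type} {T : ℕ} (n : ℕ)
    (a : Fin n → DT Q Ans O T) :
    ∃ b : DT Q Ans (Fin n → O) (n * T), ∀ f, b.run f = fun j => (a j).run f := by
  induction n with
  | zero => exact ⟨ret Fin.elim0, fun f => funext fun j => j.elim0⟩
  | succ n ih =>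
    obtain ⟨b, hb⟩ := ih fun j => a j.succ
    have hmap : ∀ o : O, ∃ c : DT Q Ans (Fin (n + 1) → O) (n * T),
        ∀ f, c.run f = Fin.cons (α := fun _ => O) o (b.run f) := fun o => by
      have hbind := exists_bind b (S := 0) fun v => ret (Fin.cons (α := fun _ => O) o v)
      rwa [Nat.zero_add] at hbind
    choose c hc using hmap
    obtain ⟨d, hd⟩ := exists_bind (a 0) c
    rw [Nat.succ_mul]
    refine ⟨d, fun f => ?_⟩
    rw [hd, hc, hb]
    funext j
    cases j using Fin.cases <;> rfl

end DT

theorem ENNReal.sum_iSup_eq_iSup_sum {α β : Type*} [Fintype α] (F : α → β → ℝ≥0∞) :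
    ∑ a, ⨆ b, F a b = ⨆ c : α → β, ∑ a, F a (c a) := by
  rcases isEmpty_or_nonempty α with hα | hα
  · simp
  rcases isEmpty_or_nonempty β with hβ | hβ
  · simp
  rw [← ENNReal.finsetSum_iSup (f := fun a (c : α → β) => F a (c a))]
  · refine Finset.sum_congr rfl fun a _ => ?_
    exact ((Function.surjective_eval (β := fun _ : α => β) a).iSup_comp (g := F a)).symm
  · intro c d
    classical
    refine ⟨fun a => if F a (c a) ≤ F a (d a) then d a else c a, fun a => ?_⟩
    dsimp only
    split_ifs with h
    · exact ⟨h, le_rfl⟩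
    · exact ⟨le_rfl, (not_le.mp h).le⟩

/-- The restriction of a weight `w` to the level set of `l` under `lab`. -/
noncomputable def levelWeight {F L : Type} [DecidableEq L] (w : F → ℝ≥0∞) (lab : F → L) (l : L) :
    F → ℝ≥0∞ :=
  fun f => if lab f = l then w f else 0

theorem sum_levelWeight_const {F L : Type} [Fintype L] [DecidableEq L] (w : F → ℝ≥0∞)
    (Φ : (F → ℝ≥0∞) → ℝ≥0∞) (hΦ : Φ (fun _ => 0) = 0) (l₀ : L) :
    ∑ l, Φ (levelWeight w (fun _ => l₀) l) = Φ w := by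
  rw [Finset.sum_eq_single l₀]
  · congr 1
    funext f
    simp [levelWeight]
  · intro l _ hl
    rw [← hΦ]
    congr 1
    funext f
    simp [levelWeight, hl.symm]
  · simp

/-- The answer of `f` to an optional query, with a default value if there is none. -/
noncomputable def optAnswer {X Y : Type} [Nonempty Y] (q : Option X) (f : X → Y) : Y :=
  q.elim (Classical.arbitrary Y) f

/-- A set of players that can advance simultaneously: each of them queries a different oracle,
and every queried oracle belongs to a player that advances as well or has finished. -/
theorem exists_simultaneous_step {ι X : Type} [Fintype ι] (h : ι → Option (ι × X))
    (hh : ∃ i, h i ≠ none) :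
    ∃ (P : Finset ι) (q : ι → Option X), P.Nonempty ∧
      (∀ i ∈ P, ∃ j x, h i = some (j, x) ∧ q j = some x) ∧
      ∀ j x, q j = some x → j ∈ P ∨ h j = none := by
  classical
  by_cases hfin : ∃ i j x, h i = some (j, x) ∧ h j = none
  · obtain ⟨i, j, x, hi, hj⟩ := hfin
    refine ⟨{i}, fun k => if k = j then some x else none, by simp, ?_, ?_⟩
    · intro k hk
      rw [Finset.mem_singleton] at hk
      exact ⟨j, x, hk ▸ hi, by simp⟩
    · intro k y hk
      right
      by_cases hkj : k = j
      · rw [hkj, hj]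
      · simp [hkj] at hk
  push Not at hfin
  let τ : ι → ι := fun i => (h i).elim i Prod.fst
  let S : Finset (Finset ι) :=
    Finset.univ.filter fun C => C.Nonempty ∧ (∀ i ∈ C, h i ≠ none) ∧ C.image τ ⊆ C
  have hS : S.Nonempty := by
    refine ⟨Finset.univ.filter fun i => h i ≠ none, ?_⟩
    simp only [S, Finset.mem_filter, Finset.mem_univ, true_and]
    refine ⟨?_, fun i hi => by simpa using hi, ?_⟩
    · obtain ⟨i, hi⟩ := hh
      exact ⟨i, by simpa using hi⟩
    · intro k hk
      simp only [Finset.mem_image, Finset.mem_filter, Finset.mem_univ, true_and] at hk ⊢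
      obtain ⟨i, hi, rfl⟩ := hk
      obtain ⟨⟨j, x⟩, hjx⟩ := Option.ne_none_iff_exists'.mp hi
      simpa [τ, hjx] using hfin i j x hjx
  obtain ⟨C, hC, hmin⟩ := S.exists_min_image Finset.card hS
  simp only [S, Finset.mem_filter, Finset.mem_univ, true_and] at hC hmin
  obtain ⟨hne, hact, hsub⟩ := hC
  have himg : C.image τ = C := by
    refine Finset.eq_of_subset_of_card_le hsub (hmin _ ⟨hne.image τ, fun i hi => hact i (hsub hi), ?_⟩)
    exact Finset.image_subset_image hsub
  have hinj : Set.InjOn τ C := Finset.card_image_iff.mp (by rw [himg])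
  refine ⟨C, fun j => if hj : ∃ i ∈ C, τ i = j then (h hj.choose).map Prod.snd else none,
    hne, ?_, ?_⟩
  · intro i hi
    obtain ⟨⟨j, x⟩, hjx⟩ := Option.ne_none_iff_exists'.mp (hact i hi)
    have hτ : τ i = j := by simp [τ, hjx]
    have hex : ∃ i ∈ C, τ i = j := ⟨i, hi, hτ⟩
    refine ⟨j, x, hjx, ?_⟩
    have : hex.choose = i := hinj hex.choose_spec.1 hi (hex.choose_spec.2.trans hτ.symm)
    simp only [dif_pos hex, this, hjx, Option.map_some]
  · intro j x hj
    left
    by_cases hex : ∃ i ∈ C, τ i = j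
    · obtain ⟨i, hi, rfl⟩ := hex
      exact himg ▸ Finset.mem_image_of_mem τ hi
    · simp [hex] at hj

namespace DT

section Value

variable {X Y O : Type} [Fintype X] [DecidableEq X] [Fintype Y]

/-- The optimal expected payoff `g` of a depth-`T` decision tree when oracles have weights `w`. -/
noncomputable def value (g : O → (X → Y) → ℝ≥0∞) (w : (X → Y) → ℝ≥0∞) (T : ℕ) : ℝ≥0∞ :=
  ⨆ a : DT X (fun _ => Y) O T, ∑ f, w f * g (a.run f) f

/-- The payoff of the output if the tree `a` has finished, and the optimal payoff achievable with
as many queries as `a` has left otherwise. -/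
noncomputable def stateValue {Q : Type} (g : O → (X → Y) → ℝ≥0∞) (w : (X → Y) → ℝ≥0∞) :
    {T : ℕ} → DT Q (fun _ => Y) O T → ℝ≥0∞
  | _, ret o => ∑ f, w f * g o f
  | T + 1, query _ _ => value g w (T + 1)

theorem value_zero_weight (g : O → (X → Y) → ℝ≥0∞) (T : ℕ) : value g (fun _ => 0) T = 0 := by
  simp [value]

theorem exists_ret_of_head_eq_none {Q : Type} (g : O → (X → Y) → ℝ≥0∞) (w : (X → Y) → ℝ≥0∞)
    {T : ℕ} (a : DT Q (fun _ => Y) O T) (ha : a.head = none) :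
    ∃ o, (∀ F, a.run F = o) ∧ stateValue g w a = ∑ f, w f * g o f := by
  cases a with
  | ret o => exact ⟨o, fun _ => rfl, rfl⟩
  | query s cont => simp [head] at ha

theorem value_le_succ (g : O → (X → Y) → ℝ≥0∞) (w : (X → Y) → ℝ≥0∞) (T : ℕ) :
    value g w T ≤ value g w (T + 1) := by
  refine iSup_le fun a => ?_
  obtain ⟨b, hb⟩ := a.exists_succ_run_eq
  refine le_iSup_of_le b ?_
  simp only [hb, le_refl]

theorem stateValue_le_value {Q : Type} (g : O → (X → Y) → ℝ≥0∞) (w : (X → Y) → ℝ≥0∞) {T : ℕ}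
    (a : DT Q (fun _ => Y) O T) : stateValue g w a ≤ value g w T := by
  cases a with
  | ret o => exact le_iSup_of_le (ret o) le_rfl
  | query q cont => exact le_rfl

theorem sum_value_levelWeight_le [DecidableEq Y] [Nonempty Y] (g : O → (X → Y) → ℝ≥0∞)
    (w : (X → Y) → ℝ≥0∞) (T : ℕ) (q : Option X) :
    ∑ l, value g (levelWeight w (optAnswer q) l) T ≤ value g w (T + 1) := by
  cases q with
  | none =>
    exact (sum_levelWeight_const w (value g · T) (value_zero_weight g T) _).trans_le
      (value_le_succ g w T)
  | some x =>
    unfold value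
    rw [ENNReal.sum_iSup_eq_iSup_sum]
    refine iSup_le fun c => le_iSup_of_le (query x c) ?_
    rw [Finset.sum_comm]
    refine Finset.sum_le_sum fun f _ => ?_
    rw [Finset.sum_eq_single (f x)]
    · simp [levelWeight, optAnswer, run]
    · intro l _ hl
      simp [levelWeight, optAnswer, hl.symm]
    · simp

theorem exists_player_step {Q : Type} [DecidableEq Y] [Nonempty Y] (g : O → (X → Y) → ℝ≥0∞)
    (w : (X → Y) → ℝ≥0∞) {T : ℕ} (a : DT Q (fun _ => Y) O T) (q : Option X) (p : Prop)
    (hp : p → a.head ≠ none) (hq : ∀ x, q = some x → p ∨ a.head = none) :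
    ∃ (T' : ℕ) (a' : Y → DT Q (fun _ => Y) O T') (b : Y → ℝ≥0∞),
      T' ≤ T ∧ (p → T' < T) ∧
      (∀ z F, (p → ∀ s, a.head = some s → F s = z) → (a' z).run F = a.run F) ∧
      (∀ l z, stateValue g (levelWeight w (optAnswer q) l) (a' z) ≤ b l) ∧
      ∑ l, b l ≤ stateValue g w a := by
  by_cases h : p
  · cases a with
    | ret o => exact absurd rfl (hp h)
    | @query t s cont =>
      refine ⟨t, cont, fun l => value g (levelWeight w (optAnswer q) l) t, by omega,
        fun _ => by omega, ?_, fun l z => stateValue_le_value _ _ _,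
        sum_value_levelWeight_le g w t q⟩
      intro z F hz
      rw [← hz h s rfl]
      rfl
  · refine ⟨T, fun _ => a, fun l => stateValue g (levelWeight w (optAnswer q) l) a, le_rfl,
      fun hp => absurd hp h, fun _ _ _ => rfl, fun _ _ => le_rfl, ?_⟩
    cases a with
    | ret o =>
      simp only [stateValue]
      rw [Finset.sum_comm]
      refine Finset.sum_le_sum fun f _ => ?_
      simp [levelWeight]
    | @query t s cont =>
      cases q with
      | none =>
        exact (sum_levelWeight_const w (value g · (t + 1)) (value_zero_weight g _) _).le
      | some x => simp [h, head] at hq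

end Value

/-- Memoryless direct product theorem, with the value of every finished player being the value of
its output. -/
theorem sum_prod_le_prod_stateValue {ι X Y : Type} [Fintype ι] [DecidableEq ι] [Fintype X]
    [DecidableEq X] [Fintype Y] [Nonempty Y] {O : ι → Type}
    (g : ∀ i, O i → (X → Y) → ℝ≥0∞) (w : ι → (X → Y) → ℝ≥0∞) (T : ι → ℕ)
    (A : ∀ i, DT (ι × X) (fun _ => Y) (O i) (T i)) :
    ∑ f : ι → X → Y, ∏ i, (w i (f i) * g i ((A i).run fun s => f s.1 s.2) (f i)) ≤
      ∏ i, stateValue (g i) (w i) (A i) := by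
  classical
  induction hm : ∑ i, T i using Nat.strong_induction_on generalizing w T with
  | _ m ih =>
  by_cases hh : ∃ i, (A i).head ≠ none
  · obtain ⟨P, q, ⟨i₀, hi₀⟩, hP, hq⟩ := exists_simultaneous_step (fun i => (A i).head) hh
    have hstep := fun i => exists_player_step (g i) (w i) (A i) (q i) (i ∈ P)
      (fun hi => by obtain ⟨j, x, hj, -⟩ := hP i hi; simp [hj]) (hq i)
    choose T' A' b hT hTlt hrun hb hsum using hstep
    let tgt : ι → ι := fun i => (A i).head.elim i Prod.fst
    have hlt : ∑ i, T' i < m := hm ▸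
      Finset.sum_lt_sum (fun i _ => hT i) ⟨i₀, Finset.mem_univ _, hTlt i₀ hi₀⟩
    calc
      _ = ∑ f : ι → X → Y, ∑ y : ι → Y, ∏ i, (levelWeight (w i) (optAnswer (q i)) (y i) (f i) *
            g i ((A' i (y (tgt i))).run fun s => f s.1 s.2) (f i)) := by
        refine Finset.sum_congr rfl fun f _ => ?_
        rw [Finset.sum_eq_single fun i => optAnswer (q i) (f i)]
        · refine Finset.prod_congr rfl fun i _ => ?_
          rw [hrun]
          · simp [levelWeight]
          · intro hi s hs
            obtain ⟨j, x, hj, hqj⟩ := hP i hi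
            obtain rfl : s = (j, x) := Option.some_injective _ (hs.symm.trans hj)
            have : tgt i = j := by simp [tgt, hs]
            simp [this, hqj, optAnswer]
        · intro y _ hy
          obtain ⟨i, hi⟩ := Function.ne_iff.mp hy
          refine Finset.prod_eq_zero (Finset.mem_univ i) ?_
          simp [levelWeight, Ne.symm hi]
        · simp
      _ = ∑ y : ι → Y, ∑ f : ι → X → Y, ∏ i, (levelWeight (w i) (optAnswer (q i)) (y i) (f i) *
            g i ((A' i (y (tgt i))).run fun s => f s.1 s.2) (f i)) := Finset.sum_comm
      _ ≤ ∑ y : ι → Y, ∏ i, b i (y i) := by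
        refine Finset.sum_le_sum fun y _ => ?_
        refine (ih _ hlt (fun i => levelWeight (w i) (optAnswer (q i)) (y i)) T'
          (fun i => A' i (y (tgt i))) rfl).trans ?_
        exact Finset.prod_le_prod' fun i _ => hb i _ _
      _ = ∏ i, ∑ l, b i l := (Fintype.prod_sum _).symm
      _ ≤ _ := Finset.prod_le_prod' fun i _ => hsum i
  · push Not at hh
    have hret : ∀ i, ∃ o, (∀ F, (A i).run F = o) ∧
        stateValue (g i) (w i) (A i) = ∑ f, w i f * g i o f := fun i =>
      exists_ret_of_head_eq_none (g i) (w i) (A i) (hh i)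
    choose o ho hval using hret
    simp only [ho, hval, Fintype.prod_sum, le_refl]

/-- Memoryless direct product theorem: players running without shared memory, each with access to
all the independent oracles, do no better than players that only query their own oracle. -/
theorem sum_prod_le_prod_value {ι X Y : Type} [Fintype ι] [DecidableEq ι] [Fintype X]
    [DecidableEq X] [Fintype Y] [Nonempty Y] {O : ι → Type}
    (g : ∀ i, O i → (X → Y) → ℝ≥0∞) (w : ι → (X → Y) → ℝ≥0∞) (T : ι → ℕ)
    (A : ∀ i, DT (ι × X) (fun _ => Y) (O i) (T i)) :
    ∑ f : ι → X → Y, ∏ i, (w i (f i) * g i ((A i).run fun s => f s.1 s.2) (f i)) ≤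
      ∏ i, value (g i) (w i) (T i) :=
  (sum_prod_le_prod_stateValue g w T A).trans
    (Finset.prod_le_prod' fun _ _ => stateValue_le_value _ _ _)

end DT

theorem ind_forall {ι : Type*} [Fintype ι] (p : ι → Prop) : ind (∀ i, p i) = ∏ i, ind (p i) := by
  classical
  unfold ind
  by_cases h : ∀ i, p i
  · simp [h]
  · rw [if_neg h]
    push Not at h
    obtain ⟨i, hi⟩ := h
    exact (Finset.prod_eq_zero (Finset.mem_univ i) (if_neg hi)).symm

theorem Game.sum_value_le_multiSec (G : Game) (n T : ℕ) :
    ∑ chs : Fin n → G.Ch,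
      DT.value (fun (o : Fin n → G.Out) f => ind (∀ j, o j ∈ G.R f (chs j)))
        (fun f => G.μ f * ∏ j, G.π f (chs j)) T ≤ G.multiSec n T := by
  unfold DT.value
  rw [ENNReal.sum_iSup_eq_iSup_sum]
  refine iSup_le fun a => le_iSup_of_le (PMF.pure a) ?_
  rw [tsum_eq_single a fun b hb => by simp [PMF.pure_apply, hb]]
  simp only [PMF.pure_apply, if_true, one_mul, tsum_fintype, Finset.mul_sum]
  rw [Finset.sum_comm]
  simp only [mul_assoc, le_refl]

/-- Sample `f 0, …, f (K-1) ∼ μ` independently and, for each salt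
`k`, challenges `ch k 0, …, ch k (n k - 1)` i.i.d. from `π (f k)`. Running a
deterministic `T`-query algorithm `B` (with joint oracle access) sequentially with
no shared memory on all inputs `(k, ch k j)`, the probability that every output is
accepted is at most `∏ k, ε_{G^{n k}}((n k)·T)`. -/
theorem multichallenge_memoryless_sdpt (G : Game) (K : ℕ) (hK : 0 < K) (T : ℕ)
    (n : Fin K → ℕ)
    (B : Fin K × G.Ch → DT (Fin K × Fin G.M) (fun _ => Fin G.N) G.Out T) :
    (∑' f : Fin K → Fin G.M → Fin G.N,
        (∏ k, G.μ (f k)) *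
          ∑' ch : (k : Fin K) → Fin (n k) → G.Ch,
            (∏ k, ∏ j, G.π (f k) (ch k j)) *
              ind (∀ k, ∀ j, (B (k, ch k j)).run (fun q => f q.1 q.2)
                ∈ G.R (f k) (ch k j)))
      ≤ ∏ k, G.multiSec (n k) (n k * T) := by
  have : Nonempty (Fin G.N) := ⟨⟨0, G.hN⟩⟩
  simp only [tsum_fintype, Finset.mul_sum]
  rw [Finset.sum_comm]
  calc
    _ ≤ ∑ ch : (k : Fin K) → Fin (n k) → G.Ch, ∏ k,
          DT.value (fun (o : Fin (n k) → G.Out) f => ind (∀ j, o j ∈ G.R f (ch k j)))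
            (fun f => G.μ f * ∏ j, G.π f (ch k j)) (n k * T) := by
      refine Finset.sum_le_sum fun ch _ => ?_
      choose A hA using fun k => DT.exists_pi (n k) fun j => B (k, ch k j)
      refine le_trans (le_of_eq ?_) (DT.sum_prod_le_prod_value _ _ _ A)
      refine Finset.sum_congr rfl fun f _ => ?_
      rw [ind_forall]
      simp only [hA, Finset.prod_mul_distrib, mul_assoc]
    _ = ∏ k, ∑ chs : Fin (n k) → G.Ch,
          DT.value (fun (o : Fin (n k) → G.Out) f => ind (∀ j, o j ∈ G.R f (chs j)))
            (fun f => G.μ f * ∏ j, G.π f (chs j)) (n k * T) := by rw [Fintype.prod_sum]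
    _ ≤ _ := Finset.prod_le_prod' fun k _ => G.sum_value_le_multiSec (n k) (n k * T)
end
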